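/- arXiv:1602.02036 — 6 statements merged into one kernel-verified Lean document; each statement's English description precedes it below -/
import Mathlib

section
/- For any two linearly independent vectors v, w ∈ ℂ²⊗ℂ² (indexed by Fin 2 × Fin 2), there exist complex numbers c₀, c₁, not both zero, and nonzero vectors x, y ∈ ℂ² such that c₀·v + c₁·w = x⊗y; that is, every two-dimensional subspace of ℂ²⊗ℂ² contains a nonzero product vector. -/
lemma aux_product (u : Fin 2 × Fin 2 → ℂ) (hu : u ≠ 0)
    (hd : u (0,0) * u (1,1) = u (0,1) * u (1,0)) :
    ∃ x y : Fin 2 → ℂ, x ≠ 0 ∧ y ≠ 0 ∧ u = fun p => x p.1 * y p.2 := by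
  obtain ⟨⟨p, q⟩, hp⟩ := Function.ne_iff.mp hu
  simp only [Pi.zero_apply] at hp
  refine ⟨fun i => u (i, q), fun j => u (p, j) / u (p, q), ?_, ?_, ?_⟩
  · exact Function.ne_iff.mpr ⟨p, hp⟩
  · exact Function.ne_iff.mpr ⟨q, by simp [hp]⟩
  · funext ⟨i, j⟩
    simp only
    rw [mul_div_assoc', eq_div_iff hp]
    fin_cases p <;> fin_cases q <;> fin_cases i <;> fin_cases j <;>
      simp only [Fin.zero_eta, Fin.mk_one] <;> first | ring1 | linear_combination hd | linear_combination -hd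

lemma aux_root (A B C : ℂ) :
    ∃ c d : ℂ, (c ≠ 0 ∨ d ≠ 0) ∧ c ^ 2 * A + c * d * B + d ^ 2 * C = 0 := by
  by_cases hC : C = 0
  · exact ⟨0, 1, by simp, by simp [hC]⟩
  · obtain ⟨s, hs⟩ := IsAlgClosed.exists_eq_mul_self (discrim C B A)
    obtain ⟨x, hx⟩ := exists_quadratic_eq_zero hC ⟨s, hs⟩
    exact ⟨1, x, by simp, by linear_combination hx⟩

theorem two_dim_subspace_contains_product_vector
    (v w : Fin 2 × Fin 2 → ℂ) (hvw : LinearIndependent ℂ ![v, w]) :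
    ∃ (c₀ c₁ : ℂ) (x y : Fin 2 → ℂ),
      (c₀ ≠ 0 ∨ c₁ ≠ 0) ∧ x ≠ 0 ∧ y ≠ 0 ∧
      c₀ • v + c₁ • w = fun p => x p.1 * y p.2 := by
  obtain ⟨c, d, hcd, h⟩ := aux_root (v (0,0) * v (1,1) - v (0,1) * v (1,0))
    (v (0,0) * w (1,1) + w (0,0) * v (1,1) - v (0,1) * w (1,0) - w (0,1) * v (1,0))
    (w (0,0) * w (1,1) - w (0,1) * w (1,0))
  have hne : c • v + d • w ≠ 0 := by
    intro h0
    have := LinearIndependent.pair_iff.mp hvw c d h0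
    tauto
  obtain ⟨x, y, hx, hy, hxy⟩ := aux_product (c • v + d • w) hne (by
    simp only [Pi.add_apply, Pi.smul_apply, smul_eq_mul]
    linear_combination h)
  exact ⟨c, d, x, y, hcd, hx, hy, hxy⟩
end

section
/- For any unitary 4×4 complex matrix U (indexed by Fin 2 × Fin 2) and any nonzero vector φ ∈ ℂ², there exist a nonzero vector ψ ∈ ℂ² and nonzero vectors x, y ∈ ℂ² such that U† (φ⊗ψ) = x⊗y, where U† is the conjugate transpose of U acting on the vector φ⊗ψ. -/
open Matrix

theorem aux_rank_one (w : Fin 2 × Fin 2 → ℂ) (hw : w ≠ 0)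
    (hd : w (0,0) * w (1,1) = w (0,1) * w (1,0)) :
    ∃ x y : Fin 2 → ℂ, x ≠ 0 ∧ y ≠ 0 ∧ w = fun p => x p.1 * y p.2 := by
  obtain ⟨⟨i, j⟩, hij⟩ := Function.ne_iff.mp hw
  have hij' : w (i, j) ≠ 0 := hij
  refine ⟨fun k => w (k, j), fun l => w (i, l) / w (i, j), ?_, ?_, ?_⟩
  · exact Function.ne_iff.mpr ⟨i, hij'⟩
  · exact Function.ne_iff.mpr ⟨j, by simp [hij']⟩
  · funext ⟨k, l⟩
    have key : w (k, l) * w (i, j) = w (k, j) * w (i, l) := by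
      clear hij hij'
      fin_cases i <;> fin_cases j <;> fin_cases k <;> fin_cases l <;>
        simp only [Fin.zero_eta, Fin.mk_one] <;> first | ring1 | linear_combination hd | linear_combination -hd
    show w (k, l) = w (k, j) * (w (i, l) / w (i, j))
    field_simp
    exact key

theorem aux_quad (a b c : ℂ) : ∃ s t : ℂ, (s ≠ 0 ∨ t ≠ 0) ∧ a * s^2 + b * s * t + c * t^2 = 0 := by
  by_cases ha : a = 0
  · exact ⟨1, 0, by simp, by simp [ha]⟩
  · obtain ⟨r, hr⟩ := IsAlgClosed.exists_pow_nat_eq (discrim a b c) (n := 2) (by norm_num)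
    obtain ⟨s, hs⟩ := exists_quadratic_eq_zero ha ⟨r, by rw [← hr]; ring⟩
    exact ⟨s, 1, by simp, by linear_combination hs⟩

theorem exists_product_preimage
    (U : Matrix (Fin 2 × Fin 2) (Fin 2 × Fin 2) ℂ)
    (hU : U ∈ Matrix.unitaryGroup (Fin 2 × Fin 2) ℂ)
    (φ : Fin 2 → ℂ) (hφ : φ ≠ 0) :
    ∃ (ψ x y : Fin 2 → ℂ), ψ ≠ 0 ∧ x ≠ 0 ∧ y ≠ 0 ∧
      Uᴴ.mulVec (fun p => φ p.1 * ψ p.2) = fun p => x p.1 * y p.2 := by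
  obtain ⟨v, hv⟩ : ∃ v : Fin 2 → Fin 2 × Fin 2 → ℂ, ∀ ψ : Fin 2 → ℂ, ∀ q,
      Uᴴ.mulVec (fun p => φ p.1 * ψ p.2) q = ψ 0 * v 0 q + ψ 1 * v 1 q := by
    refine ⟨fun k q => ∑ i, Uᴴ q (i, k) * φ i, fun ψ q => ?_⟩
    simp only [Matrix.mulVec, dotProduct, Fintype.sum_prod_type, Fin.sum_univ_two]
    ring
  obtain ⟨s, t, hst, h⟩ := aux_quad
    (v 0 (0,0) * v 0 (1,1) - v 0 (0,1) * v 0 (1,0))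
    (v 0 (0,0) * v 1 (1,1) + v 1 (0,0) * v 0 (1,1) - v 0 (0,1) * v 1 (1,0) - v 1 (0,1) * v 0 (1,0))
    (v 1 (0,0) * v 1 (1,1) - v 1 (0,1) * v 1 (1,0))
  have hψ : (![s, t] : Fin 2 → ℂ) ≠ 0 := by
    intro h0
    have h1 := congrFun h0 0
    have h2 := congrFun h0 1
    simp at h1 h2
    simp [h1, h2] at hst
  obtain ⟨x, y, hx, hy, hxy⟩ := aux_rank_one
    (Uᴴ.mulVec (fun p => φ p.1 * (![s, t] : Fin 2 → ℂ) p.2)) (by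
      intro h0
      have h1 := congrArg (U.mulVec) h0
      rw [Matrix.mulVec_mulVec, ← Matrix.star_eq_conjTranspose,
        Matrix.mem_unitaryGroup_iff.mp hU, Matrix.one_mulVec, Matrix.mulVec_zero] at h1
      obtain ⟨i, hi⟩ := Function.ne_iff.mp hφ
      obtain ⟨j, hj⟩ := Function.ne_iff.mp hψ
      exact mul_ne_zero hi hj (congrFun h1 (i, j))) (by
      simp only [hv, Matrix.cons_val_zero, Matrix.cons_val_one]
      linear_combination h)
  exact ⟨_, x, y, hψ, hx, hy, hxy⟩
end

section
/- For any unitary 4×4 complex matrix U (indexed by Fin 2 × Fin 2), there exist unit vectors a₀, e₀, a₁, e₁, ψ₀, ψ₁ ∈ ℂ² such that U (a₀⊗e₀) = b₀⊗ψ₀ and U (a₁⊗e₁) = b₁⊗ψ₁, where b₀ = (1,0) and b₁ = (0,1) are the standard basis vectors of ℂ². In particular, there exist two product input unit vectors whose images under U are product vectors with orthogonal first factors. -/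
open Matrix

lemma aux_normalize (v : Fin 2 → ℂ) (hv : v ≠ 0) :
    ∃ c : ℂ, (∑ i, Complex.normSq ((c • v) i)) = 1 := by
  have hpos : 0 < ∑ i, Complex.normSq (v i) := by
    obtain ⟨i, hi⟩ := Function.ne_iff.mp hv
    exact Finset.sum_pos' (fun _ _ => Complex.normSq_nonneg _)
      ⟨i, Finset.mem_univ _, Complex.normSq_pos.mpr hi⟩
  set S := ∑ i, Complex.normSq (v i) with hS
  refine ⟨((Real.sqrt S)⁻¹ : ℝ), ?_⟩
  simp only [Pi.smul_apply, smul_eq_mul, Complex.normSq_mul, ← Finset.mul_sum, ← hS,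
    Complex.normSq_ofReal]
  rw [← mul_inv, Real.mul_self_sqrt hpos.le, inv_mul_cancel₀ hpos.ne']

lemma aux_root_s7 (A B : Matrix (Fin 2) (Fin 2) ℂ) :
    ∃ a : Fin 2 → ℂ, a ≠ 0 ∧ (a 0 • A + a 1 • B).det = 0 := by
  by_cases hB : B.det = 0
  · exact ⟨![0, 1], fun h => by simpa using congrFun h 1, by simp [hB]⟩
  · let q : ℂ := A 0 0 * B 1 1 + B 0 0 * A 1 1 - A 0 1 * B 1 0 - B 0 1 * A 1 0
    obtain ⟨s, hs⟩ := IsAlgClosed.exists_eq_mul_self (discrim B.det q A.det)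
    obtain ⟨t, ht⟩ := exists_quadratic_eq_zero hB ⟨s, hs⟩
    refine ⟨![1, t], fun h => by simpa using congrFun h 0, ?_⟩
    rw [← ht]
    simp only [det_fin_two, q, Matrix.add_apply, Matrix.smul_apply, smul_eq_mul,
      Matrix.cons_val_zero, Matrix.cons_val_one]
    ring

lemma aux_kernel (A B : Matrix (Fin 2) (Fin 2) ℂ) :
    ∃ a e : Fin 2 → ℂ, (∑ i, Complex.normSq (a i)) = 1 ∧ (∑ i, Complex.normSq (e i)) = 1 ∧
      (a 0 • A + a 1 • B).mulVec e = 0 := by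
  obtain ⟨a, ha, hd⟩ := aux_root_s7 A B
  obtain ⟨e, he, hk⟩ := Matrix.exists_mulVec_eq_zero_iff.mpr hd
  obtain ⟨c, hc⟩ := aux_normalize a ha
  obtain ⟨d, hd'⟩ := aux_normalize e he
  refine ⟨c • a, d • e, hc, hd', ?_⟩
  have : ((c • a) 0 • A + (c • a) 1 • B) = c • (a 0 • A + a 1 • B) := by
    simp [smul_smul, smul_add]
  rw [this, Matrix.mulVec_smul, Matrix.smul_mulVec, hk]
  simp

lemma aux_norm (U : Matrix (Fin 2 × Fin 2) (Fin 2 × Fin 2) ℂ)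
    (hU : U ∈ Matrix.unitaryGroup (Fin 2 × Fin 2) ℂ) (v : Fin 2 × Fin 2 → ℂ) :
    ∑ p, Complex.normSq (U.mulVec v p) = ∑ p, Complex.normSq (v p) := by
  have key : ∀ w : Fin 2 × Fin 2 → ℂ,
      ((∑ p, Complex.normSq (w p) : ℝ) : ℂ) = star w ⬝ᵥ w := by
    intro w
    simp [dotProduct, Complex.normSq_eq_conj_mul_self]
  have h : star U * U = 1 := Matrix.mem_unitaryGroup_iff'.mp hU
  rw [← Complex.ofReal_inj, key, key, Matrix.star_mulVec, ← Matrix.dotProduct_mulVec,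
    Matrix.mulVec_mulVec, ← Matrix.star_eq_conjTranspose, h, Matrix.one_mulVec]

lemma aux_main (U : Matrix (Fin 2 × Fin 2) (Fin 2 × Fin 2) ℂ)
    (hU : U ∈ Matrix.unitaryGroup (Fin 2 × Fin 2) ℂ) (k : Fin 2) :
    ∃ a e : Fin 2 → ℂ, (∑ i, Complex.normSq (a i)) = 1 ∧ (∑ i, Complex.normSq (e i)) = 1 ∧
      (∀ j, U.mulVec (fun p => a p.1 * e p.2) (k, j) = 0) ∧
      ∑ p, Complex.normSq (U.mulVec (fun p => a p.1 * e p.2) p) = 1 := by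
  obtain ⟨a, e, ha, he, hk⟩ := aux_kernel
    (Matrix.of fun j l => U (k, j) (0, l)) (Matrix.of fun j l => U (k, j) (1, l))
  refine ⟨a, e, ha, he, fun j => ?_, ?_⟩
  · refine Eq.trans ?_ (congrFun hk j)
    simp [Matrix.mulVec, dotProduct, Fintype.sum_prod_type, Fin.sum_univ_two]
    ring
  · rw [aux_norm U hU]
    simp only [Complex.normSq_mul, Fintype.sum_prod_type, ← Finset.mul_sum, he, mul_one, ha]

theorem two_qubit_conferencing_capacity_one_bit
    (U : Matrix (Fin 2 × Fin 2) (Fin 2 × Fin 2) ℂ)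
    (hU : U ∈ Matrix.unitaryGroup (Fin 2 × Fin 2) ℂ) :
    ∃ a₀ e₀ a₁ e₁ ψ₀ ψ₁ : Fin 2 → ℂ,
      (∑ i, Complex.normSq (a₀ i)) = 1 ∧
      (∑ i, Complex.normSq (e₀ i)) = 1 ∧
      (∑ i, Complex.normSq (a₁ i)) = 1 ∧
      (∑ i, Complex.normSq (e₁ i)) = 1 ∧
      (∑ i, Complex.normSq (ψ₀ i)) = 1 ∧
      (∑ i, Complex.normSq (ψ₁ i)) = 1 ∧
      U.mulVec (fun p => a₀ p.1 * e₀ p.2)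
        = (fun p => (![1, 0] : Fin 2 → ℂ) p.1 * ψ₀ p.2) ∧
      U.mulVec (fun p => a₁ p.1 * e₁ p.2)
        = fun p => (![0, 1] : Fin 2 → ℂ) p.1 * ψ₁ p.2 := by
  obtain ⟨a₀, e₀, ha₀, he₀, h₀, n₀⟩ := aux_main U hU 1
  obtain ⟨a₁, e₁, ha₁, he₁, h₁, n₁⟩ := aux_main U hU 0
  refine ⟨a₀, e₀, a₁, e₁, fun j => U.mulVec (fun p => a₀ p.1 * e₀ p.2) (0, j),
    fun j => U.mulVec (fun p => a₁ p.1 * e₁ p.2) (1, j), ha₀, he₀, ha₁, he₁, ?_, ?_, ?_, ?_⟩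
  · rw [Fintype.sum_prod_type, Fin.sum_univ_two] at n₀
    simpa only [h₀, map_zero, Finset.sum_const_zero, add_zero] using n₀
  · rw [Fintype.sum_prod_type, Fin.sum_univ_two] at n₁
    simpa only [h₁, map_zero, Finset.sum_const_zero, zero_add] using n₁
  · ext ⟨i, j⟩
    fin_cases i
    · simp
    · simpa using h₀ j
  · ext ⟨i, j⟩
    fin_cases i
    · simpa using h₁ j
    · simp
end

section
/- Let d ≥ 1 and, for m, n ∈ Fin d, define the d×d complex matrix σ_{m,n} by: σ_{m,m} = |m⟩⟨m|; for m < n, σ_{m,n} = (1/2)(|m⟩+|n⟩)(⟨m|+⟨n|); for m > n, σ_{m,n} = (1/2)(|m⟩+i|n⟩)(⟨m|−i⟨n|), where |m⟩ denotes the m-th standard basis vector and for a vector v, |v⟩⟨v| is the matrix with entries v(j)·conj(v(j')). Then the family {σ_{m,n} : m, n ∈ Fin d} spans the full space of d×d complex matrices as a ℂ-vector space. -/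
open Matrix

/-- Standard basis vector `|m⟩` of `ℂᵈ`. -/
noncomputable def ket {d : ℕ} (m : Fin d) : Fin d → ℂ :=
  fun j => if j = m then 1 else 0

/-- Rank-one matrix `|v⟩⟨v|`. -/
noncomputable def outerProd {d : ℕ} (v : Fin d → ℂ) : Matrix (Fin d) (Fin d) ℂ :=
  Matrix.of fun j j' => v j * (starRingEnd ℂ) (v j')

/-- The spanning family `σ_{m,n}` of density matrices. -/
noncomputable def sigmaFam {d : ℕ} (m n : Fin d) : Matrix (Fin d) (Fin d) ℂ :=
  if m = n then outerProd (ket m)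
  else if m < n then (1 / 2 : ℂ) • outerProd (fun j => ket m j + ket n j)
  else (1 / 2 : ℂ) • outerProd (fun j => ket m j + Complex.I * ket n j)

lemma outer_add {d : ℕ} (m n : Fin d) (c : ℂ) :
    outerProd (fun j => ket m j + c * ket n j) =
      Matrix.single m m 1 + (starRingEnd ℂ c) • Matrix.single m n 1
        + c • Matrix.single n m 1 + (c * starRingEnd ℂ c) • Matrix.single n n (1 : ℂ) := by
  ext i j
  simp only [outerProd, ket, Matrix.of_apply, Matrix.add_apply, Matrix.smul_apply,
    Matrix.single_apply, smul_eq_mul, eq_comm (a := i), eq_comm (a := j), map_add, map_mul]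
  by_cases h1 : m = i <;> by_cases h2 : n = i <;> by_cases h3 : m = j <;> by_cases h4 : n = j <;>
    simp only [if_pos, if_neg, h1, h2, h3, h4, and_true, true_and, and_false, false_and, if_true,
      if_false, map_one, map_zero] <;> simp_all <;> ring

lemma sigma_diag {d : ℕ} (m : Fin d) : sigmaFam m m = Matrix.single m m 1 := by
  have := outer_add m m 0
  simpa [sigmaFam] using this

lemma sigma_lt {d : ℕ} (m n : Fin d) (h : m < n) : sigmaFam m n =
    (1 / 2 : ℂ) • (Matrix.single m m 1 + Matrix.single m n 1
        + Matrix.single n m 1 + Matrix.single n n (1 : ℂ)) := by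
  have := outer_add m n 1
  simp only [one_mul, map_one, one_smul] at this
  rw [sigmaFam, if_neg h.ne, if_pos h, this]

lemma sigma_gt {d : ℕ} (m n : Fin d) (h : m < n) : sigmaFam n m =
    (1 / 2 : ℂ) • (Matrix.single n n 1 + (-Complex.I) • Matrix.single n m 1
        + Complex.I • Matrix.single m n 1 + Matrix.single m m (1 : ℂ)) := by
  have := outer_add n m Complex.I
  simp only [Complex.conj_I, mul_neg, Complex.I_mul_I, neg_neg, one_smul] at this
  rw [sigmaFam, if_neg h.ne', if_neg h.not_gt, this]

lemma single_lt {d : ℕ} (m n : Fin d) (h : m < n) : Matrix.single m n (1 : ℂ) =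
    sigmaFam m n - Complex.I • sigmaFam n m
      + ((Complex.I - 1) / 2) • (sigmaFam m m + sigmaFam n n) := by
  rw [sigma_lt m n h, sigma_gt m n h, sigma_diag, sigma_diag]
  have hI := Complex.I_mul_I
  match_scalars <;> first
    | ring1
    | linear_combination (1 / 2 : ℂ) * hI
    | linear_combination (-1 / 2 : ℂ) * hI

lemma single_gt {d : ℕ} (m n : Fin d) (h : m < n) : Matrix.single n m (1 : ℂ) =
    sigmaFam m n + Complex.I • sigmaFam n m
      + ((-Complex.I - 1) / 2) • (sigmaFam m m + sigmaFam n n) := by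
  rw [sigma_lt m n h, sigma_gt m n h, sigma_diag, sigma_diag]
  have hI := Complex.I_mul_I
  match_scalars <;> first
    | ring1
    | linear_combination (1 / 2 : ℂ) * hI
    | linear_combination (-1 / 2 : ℂ) * hI

theorem sigmaFam_spans (d : ℕ) (hd : 1 ≤ d) :
    Submodule.span ℂ (Set.range fun mn : Fin d × Fin d => sigmaFam mn.1 mn.2) = ⊤ := by
  have hmem : ∀ m n : Fin d, sigmaFam m n ∈
      Submodule.span ℂ (Set.range fun mn : Fin d × Fin d => sigmaFam mn.1 mn.2) :=
    fun m n => Submodule.subset_span ⟨(m, n), rfl⟩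
  rw [eq_top_iff]
  intro A _
  rw [Matrix.matrix_eq_sum_single A]
  refine Submodule.sum_mem _ fun m _ => Submodule.sum_mem _ fun n _ => ?_
  have hs : Matrix.single m n (A m n) = A m n • Matrix.single m n (1 : ℂ) := by simp
  rw [hs]
  refine Submodule.smul_mem _ _ ?_
  rcases lt_trichotomy m n with h | h | h
  · rw [single_lt m n h]
    exact add_mem (sub_mem (hmem _ _) (Submodule.smul_mem _ _ (hmem _ _)))
      (Submodule.smul_mem _ _ (add_mem (hmem _ _) (hmem _ _)))
  · subst h
    rw [← sigma_diag]
    exact hmem _ _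
  · rw [single_gt n m h]
    exact add_mem (add_mem (hmem _ _) (Submodule.smul_mem _ _ (hmem _ _)))
      (Submodule.smul_mem _ _ (add_mem (hmem _ _) (hmem _ _)))
end

section
/- Let u ∈ [0, π/2]. Then the set of real numbers { H₂(1/2 + √(1/4 − 4·c(1−c)·q(1−q)·(cos u)²)) : c ∈ [0,1], q ∈ [0,1] } has greatest element H₂((1 + sin u)/2), attained at c = q = 1/2; i.e., IsGreatest of that set is H₂((1+sin u)/2). -/
/-- The binary entropy `H₂(p) = −p·log₂ p − (1−p)·log₂(1−p)`. -/
noncomputable def binEnt (p : ℝ) : ℝ :=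
  -p * Real.logb 2 p - (1 - p) * Real.logb 2 (1 - p)

theorem binEnt_eq_div (p : ℝ) : binEnt p = Real.binEntropy p / Real.log 2 := by
  unfold binEnt Real.binEntropy Real.logb
  rw [Real.log_inv, Real.log_inv]
  ring

theorem controlled_unitary_capacity_isGreatest (u : ℝ) (hu : u ∈ Set.Icc 0 (Real.pi / 2)) :
    IsGreatest
      { r : ℝ | ∃ c ∈ Set.Icc (0 : ℝ) 1, ∃ q ∈ Set.Icc (0 : ℝ) 1,
          r = binEnt (1 / 2 +
            Real.sqrt (1 / 4 - 4 * c * (1 - c) * q * (1 - q) * Real.cos u ^ 2)) }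
      (binEnt ((1 + Real.sin u) / 2)) := by
  have hs : 0 ≤ Real.sin u :=
    Real.sin_nonneg_of_nonneg_of_le_pi hu.1 (by linarith [hu.2, Real.pi_pos])
  have hs1 := Real.sin_le_one u
  have hsc := Real.sin_sq_add_cos_sq u
  constructor
  · refine ⟨1/2, by norm_num, 1/2, by norm_num, ?_⟩
    have h : (1 / 4 - 4 * (1/2) * (1 - 1/2) * (1/2) * (1 - 1/2) * Real.cos u ^ 2 : ℝ)
        = (Real.sin u / 2) ^ 2 := by linarith
    rw [h, Real.sqrt_sq (by linarith)]
    congr 1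
    ring
  · rintro r ⟨c, ⟨hc0, hc1⟩, q, ⟨hq0, hq1⟩, rfl⟩
    rw [binEnt_eq_div, binEnt_eq_div]
    have hx0 : 0 ≤ c * (1 - c) := mul_nonneg hc0 (by linarith)
    have hy0 : 0 ≤ q * (1 - q) := mul_nonneg hq0 (by linarith)
    have hx1 : c * (1 - c) ≤ 1/4 := by nlinarith [sq_nonneg (c - 1/2)]
    have hy1 : q * (1 - q) ≤ 1/4 := by nlinarith [sq_nonneg (q - 1/2)]
    have hxy : (c * (1 - c)) * (q * (1 - q)) ≤ 1/4 * (1/4) :=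
      mul_le_mul hx1 hy1 hy0 (by norm_num)
    have hxy0 := mul_nonneg hx0 hy0
    have h1 := mul_le_mul_of_nonneg_right hxy (sq_nonneg (Real.cos u))
    have h0 := mul_nonneg hxy0 (sq_nonneg (Real.cos u))
    have hlow : Real.sin u / 2 ≤
        Real.sqrt (1 / 4 - 4 * c * (1 - c) * q * (1 - q) * Real.cos u ^ 2) := by
      apply Real.le_sqrt_of_sq_le
      linarith
    have hup : Real.sqrt (1 / 4 - 4 * c * (1 - c) * q * (1 - q) * Real.cos u ^ 2) ≤ 1 / 2 := by
      apply Real.sqrt_le_iff.mpr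
      constructor
      · norm_num
      · linarith
    apply div_le_div_of_nonneg_right _ (Real.log_nonneg (by norm_num))
    apply Real.binEntropy_strictAntiOn.antitoneOn
    · constructor <;> linarith
    · constructor <;> linarith
    · linarith
end

section
/- For every p ∈ [0,1], the binary entropy satisfies H₂(p) ≤ 2·√(p(1−p)). -/
/-- The binary entropy gap. -/
noncomputable def gapD (p : ℝ) : ℝ :=
  2 * Real.log 2 * Real.sqrt (p * (1 - p)) - Real.binEntropy p

noncomputable def gapD1 (p : ℝ) : ℝ :=
  Real.log 2 * (1 - 2 * p) / Real.sqrt (p * (1 - p)) - (Real.log (1 - p) - Real.log p)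

noncomputable def gapD2 (p : ℝ) : ℝ :=
  (1 / (p * (1 - p))) * (1 - Real.log 2 / (2 * Real.sqrt (p * (1 - p))))

lemma gapD_cont : Continuous gapD := by
  unfold gapD
  fun_prop

lemma gapD_symm (p : ℝ) : gapD (1 - p) = gapD p := by
  unfold gapD
  rw [Real.binEntropy_one_sub]
  ring_nf

lemma gapD_half : gapD (1 / 2) = 0 := by
  unfold gapD
  have h : Real.sqrt ((1 / 2 : ℝ) * (1 - 1 / 2)) = 1 / 2 := by
    rw [show ((1 / 2 : ℝ) * (1 - 1 / 2)) = (1 / 2) ^ 2 by norm_num]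
    exact Real.sqrt_sq (by norm_num)
  rw [h, one_div, Real.binEntropy_two_inv]
  ring

lemma hasDeriv_sqrt (p : ℝ) (h0 : 0 < p) (h1 : p < 1) :
    HasDerivAt (fun p : ℝ => Real.sqrt (p * (1 - p)))
      ((1 - 2 * p) / (2 * Real.sqrt (p * (1 - p)))) p := by
  have hq : 0 < p * (1 - p) := mul_pos h0 (by linarith)
  have h : HasDerivAt (fun p : ℝ => p * (1 - p)) (1 - 2 * p) p := by
    have := (hasDerivAt_id' p).mul ((hasDerivAt_id' p).const_sub 1)
    exact this.congr_deriv (by ring)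
  exact h.sqrt hq.ne'

lemma gapD_deriv (p : ℝ) (h0 : 0 < p) (h1 : p < 1) : HasDerivAt gapD (gapD1 p) p := by
  have := ((hasDeriv_sqrt p h0 h1).const_mul (2 * Real.log 2)).sub
    (Real.hasDerivAt_binEntropy h0.ne' h1.ne)
  refine HasDerivAt.congr_deriv (f := gapD) this ?_
  have hs : 0 < Real.sqrt (p * (1 - p)) := Real.sqrt_pos.2 (mul_pos h0 (by linarith))
  unfold gapD1
  field_simp

lemma gapD1_deriv (p : ℝ) (h0 : 0 < p) (h1 : p < 1) : HasDerivAt gapD1 (gapD2 p) p := by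
  have hq : 0 < p * (1 - p) := mul_pos h0 (by linarith)
  have hs : 0 < Real.sqrt (p * (1 - p)) := Real.sqrt_pos.2 hq
  have h1p : 0 < 1 - p := by linarith
  have hn : HasDerivAt (fun p : ℝ => Real.log 2 * (1 - 2 * p)) (Real.log 2 * (-(2 * 1))) p :=
    (((hasDerivAt_id' p).const_mul 2).const_sub 1).const_mul _
  have hl : HasDerivAt (fun p : ℝ => Real.log (1 - p)) (-1 / (1 - p)) p :=
    ((hasDerivAt_id' p).const_sub 1).log h1p.ne'
  have hl2 : HasDerivAt (fun p : ℝ => Real.log p) (p⁻¹) p := Real.hasDerivAt_log h0.ne'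
  have := (hn.div (hasDeriv_sqrt p h0 h1) hs.ne').sub (hl.sub hl2)
  refine HasDerivAt.congr_deriv (f := gapD1) this ?_
  unfold gapD2
  have hsq : Real.sqrt (p * (1 - p)) ^ 2 = p * (1 - p) := Real.sq_sqrt hq.le
  generalize Real.sqrt (p * (1 - p)) = s at *
  have e1 : -1 / (1 - p) - p⁻¹ = -(1 / s ^ 2) := by
    rw [hsq]; field_simp; ring
  rw [e1, ← hsq]
  field_simp
  linear_combination (-4 * Real.log 2) * hsq

lemma gapD_nonneg (p : ℝ) (h0 : 0 ≤ p) (h2 : p ≤ 1 / 2) : 0 ≤ gapD p := by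
  have L0 : 0 < Real.log 2 := Real.log_pos (by norm_num)
  have L1 : Real.log 2 < 1 := by linarith [Real.log_two_lt_d9]
  set L := Real.log 2 with hL
  have hr : 0 < 1 - L ^ 2 := by nlinarith
  set r := Real.sqrt (1 - L ^ 2) with hrdef
  have hr0 : 0 < r := Real.sqrt_pos.2 hr
  have hr2 : r ^ 2 = 1 - L ^ 2 := Real.sq_sqrt hr.le
  have hr1 : r < 1 := by nlinarith
  set a := (1 - r) / 2 with ha
  have haL : a * (1 - a) = (L / 2) ^ 2 := by rw [ha]; linear_combination (-1 / 4) * hr2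
  -- convexity in the middle
  have mid : ∀ x, a ≤ x → x ≤ 1 - a → 0 ≤ gapD x := by
    have hc : ConvexOn ℝ (Set.Icc a (1 - a)) gapD := by
      refine convexOn_of_hasDerivWithinAt2_nonneg (f' := gapD1) (f'' := gapD2)
        (convex_Icc _ _) gapD_cont.continuousOn ?_ ?_ ?_
      all_goals
        rw [interior_Icc]
        rintro x ⟨hx1, hx2⟩
        have hx0 : 0 < x := by linarith
        have hx3 : x < 1 := by linarith
      · exact (gapD_deriv x hx0 hx3).hasDerivWithinAt
      · exact (gapD1_deriv x hx0 hx3).hasDerivWithinAt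
      · have hq : 0 < x * (1 - x) := mul_pos hx0 (by linarith)
        have hs : L / 2 ≤ Real.sqrt (x * (1 - x)) := by
          apply Real.le_sqrt_of_sq_le
          rw [← haL]; nlinarith
        unfold gapD2
        refine mul_nonneg (by positivity) ?_
        rw [sub_nonneg, div_le_one (by linarith)]
        linarith
    intro x hx1 hx2
    have := hc.2 (show x ∈ Set.Icc a (1 - a) from ⟨hx1, hx2⟩)
      (show 1 - x ∈ Set.Icc a (1 - a) from ⟨by linarith, by linarith⟩)
      (show (0 : ℝ) ≤ 1 / 2 by norm_num) (show (0 : ℝ) ≤ 1 / 2 by norm_num) (by norm_num)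
    simp only [smul_eq_mul] at this
    rw [show 1 / 2 * x + 1 / 2 * (1 - x) = 1 / 2 by ring, gapD_half, gapD_symm] at this
    linarith
  rcases le_total a p with h | h
  · exact mid p h (by linarith)
  have hc : ConcaveOn ℝ (Set.Icc 0 a) gapD := by
    refine concaveOn_of_hasDerivWithinAt2_nonpos (f' := gapD1) (f'' := gapD2)
      (convex_Icc _ _) gapD_cont.continuousOn ?_ ?_ ?_
    all_goals
      rw [interior_Icc]
      rintro x ⟨hx0, hx2⟩
      have hx3 : x < 1 := by linarith
    · exact (gapD_deriv x hx0 hx3).hasDerivWithinAt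
    · exact (gapD1_deriv x hx0 hx3).hasDerivWithinAt
    · have hq : 0 < x * (1 - x) := mul_pos hx0 (by linarith)
      have hs0 : 0 < Real.sqrt (x * (1 - x)) := Real.sqrt_pos.2 hq
      have hs : Real.sqrt (x * (1 - x)) ≤ L / 2 := by
        apply Real.sqrt_le_iff.2 ⟨by linarith, ?_⟩
        rw [← haL]; nlinarith
      unfold gapD2
      refine mul_nonpos_of_nonneg_of_nonpos (by positivity) ?_
      rw [sub_nonpos, one_le_div (by linarith)]
      linarith
  have h00 : gapD 0 = 0 := by simp [gapD]
  have haa : 0 ≤ gapD a := mid a le_rfl (by linarith)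
  have ha0 : 0 < a := by linarith
  have := hc.min_le_of_mem_Icc (x := 0) (y := a) (z := p) ⟨le_rfl, ha0.le⟩ ⟨ha0.le, le_rfl⟩ ⟨h0, h⟩
  rw [h00, min_eq_left haa] at this
  exact this

theorem binEnt_le_two_sqrt (p : ℝ) (hp : p ∈ Set.Icc (0 : ℝ) 1) :
    binEnt p ≤ 2 * Real.sqrt (p * (1 - p)) := by
  have L0 : 0 < Real.log 2 := Real.log_pos (by norm_num)
  have h : 0 ≤ gapD p := by
    rcases le_total p (1 / 2) with h | h
    · exact gapD_nonneg p hp.1 h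
    · rw [← gapD_symm]
      exact gapD_nonneg (1 - p) (by linarith [hp.2]) (by linarith)
  have e : binEnt p = Real.binEntropy p / Real.log 2 := by
    simp only [binEnt, Real.binEntropy, Real.logb, Real.log_inv]
    ring
  rw [e, div_le_iff₀ L0]
  unfold gapD at h
  linarith
end
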